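/- arXiv:1901.11166 — 9 statements merged into one kernel-verified Lean document; each statement's English description precedes it below -/
import Mathlib

section
/- Let V be a module over ℝ and let ω₁, ω₂, ω₃ : V ≃ₗ[ℝ] V* be antisymmetric linear equivalences onto the dual module. Define the endomorphisms I₁ = ω₃⁻¹ ∘ ω₂, I₂ = ω₁⁻¹ ∘ ω₃, I₃ = ω₂⁻¹ ∘ ω₁ of V. If I₁ ∘ I₁ = −id, I₂ ∘ I₂ = −id and I₃ ∘ I₃ = −id, then I₁ ∘ I₂ ∘ I₃ = −id. -/
/-- Three square roots of `-1` in a ring with `q * p * r = 1` satisfy the quaternion relation. -/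
theorem mul_mul_eq_neg_one_of_sq_eq_neg_one {R : Type*} [Ring R] {p q r : R}
    (hp : p * p = -1) (hq : q * q = -1) (hr : r * r = -1) (h : q * p * r = 1) :
    p * (q * r) = -1 := by
  have hqp : q * p = -r := by
    calc q * p = -(q * p * (r * r)) := by rw [hr]; simp
      _ = -(q * p * r * r) := by noncomm_ring
      _ = -r := by rw [h, one_mul]
  have hsq : (q * p) * (q * p) = -1 := by rw [hqp, neg_mul_neg, hr]
  have hpq : p * q = -(q * p) := by
    calc p * q = (q * q) * (p * q) * (p * p) := by rw [hp, hq]; simp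
      _ = q * ((q * p) * (q * p)) * p := by noncomm_ring
      _ = -(q * p) := by rw [hsq]; simp
  rw [← mul_assoc, hpq, neg_mul, h]


/-- the algebraic condition on a triplet of antisymmetric
invertible maps `ωᵢ : V ≃ₗ[ℝ] V*` implies the quaternion relation
`I₁ ∘ I₂ ∘ I₃ = -id`. -/
theorem stmt0 {V : Type*} [AddCommGroup V] [Module ℝ V]
    (ω₁ ω₂ ω₃ : V ≃ₗ[ℝ] Module.Dual ℝ V)
    (h₁ : ∀ x y : V, ω₁ x y = -(ω₁ y x))
    (h₂ : ∀ x y : V, ω₂ x y = -(ω₂ y x))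
    (h₃ : ∀ x y : V, ω₃ x y = -(ω₃ y x))
    (I₁ : V →ₗ[ℝ] V) (I₂ : V →ₗ[ℝ] V) (I₃ : V →ₗ[ℝ] V)
    (hI₁ : I₁ = ω₃.symm.toLinearMap ∘ₗ ω₂.toLinearMap)
    (hI₂ : I₂ = ω₁.symm.toLinearMap ∘ₗ ω₃.toLinearMap)
    (hI₃ : I₃ = ω₂.symm.toLinearMap ∘ₗ ω₁.toLinearMap)
    (hsq₁ : I₁ ∘ₗ I₁ = -LinearMap.id)
    (hsq₂ : I₂ ∘ₗ I₂ = -LinearMap.id)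
    (hsq₃ : I₃ ∘ₗ I₃ = -LinearMap.id) :
    I₁ ∘ₗ I₂ ∘ₗ I₃ = -LinearMap.id := by
  refine mul_mul_eq_neg_one_of_sq_eq_neg_one (R := Module.End ℝ V) hsq₁ hsq₂ hsq₃ ?_
  ext x
  simp [hI₁, hI₂, hI₃]
end

section
/- Let V be a module over ℝ and let ω₁, ω₂, ω₃ : V ≃ₗ[ℝ] V* be antisymmetric linear equivalences onto the dual module. Define I₁ = ω₃⁻¹ ∘ ω₂, I₂ = ω₁⁻¹ ∘ ω₃, I₃ = ω₂⁻¹ ∘ ω₁, and assume I₁ ∘ I₁ = −id, I₂ ∘ I₂ = −id, I₃ ∘ I₃ = −id. Then the three bilinear forms gᵢ(x,y) := −(ωᵢ x)(Iᵢ y) (i = 1,2,3) coincide, g₁ = g₂ = g₃, and the common bilinear form is symmetric: g₁(x,y) = g₁(y,x) for all x, y ∈ V. -/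
/-- under the algebraic condition, the three bilinear forms
`gᵢ(x,y) = -(ωᵢ x)(Iᵢ y)` coincide and are symmetric. -/
theorem stmt1 {V : Type*} [AddCommGroup V] [Module ℝ V]
    (ω₁ ω₂ ω₃ : V ≃ₗ[ℝ] Module.Dual ℝ V)
    (h₁ : ∀ x y : V, ω₁ x y = -(ω₁ y x))
    (h₂ : ∀ x y : V, ω₂ x y = -(ω₂ y x))
    (h₃ : ∀ x y : V, ω₃ x y = -(ω₃ y x))
    (I₁ : V →ₗ[ℝ] V) (I₂ : V →ₗ[ℝ] V) (I₃ : V →ₗ[ℝ] V)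
    (hI₁ : I₁ = ω₃.symm.toLinearMap ∘ₗ ω₂.toLinearMap)
    (hI₂ : I₂ = ω₁.symm.toLinearMap ∘ₗ ω₃.toLinearMap)
    (hI₃ : I₃ = ω₂.symm.toLinearMap ∘ₗ ω₁.toLinearMap)
    (hsq₁ : I₁ ∘ₗ I₁ = -LinearMap.id)
    (hsq₂ : I₂ ∘ₗ I₂ = -LinearMap.id)
    (hsq₃ : I₃ ∘ₗ I₃ = -LinearMap.id)
    (g₁ g₂ g₃ : V → V → ℝ)
    (hg₁ : ∀ x y : V, g₁ x y = -(ω₁ x (I₁ y)))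
    (hg₂ : ∀ x y : V, g₂ x y = -(ω₂ x (I₂ y)))
    (hg₃ : ∀ x y : V, g₃ x y = -(ω₃ x (I₃ y))) :
    g₁ = g₂ ∧ g₂ = g₃ ∧ (∀ x y : V, g₁ x y = g₁ y x) := by
  have a₁ (x : V) : ω₃ (I₁ x) = ω₂ x := by simp [hI₁]
  have a₂ (x : V) : ω₁ (I₂ x) = ω₃ x := by simp [hI₂]
  have a₃ (x : V) : ω₂ (I₃ x) = ω₁ x := by simp [hI₃]
  have s₁ (x : V) : I₁ (I₁ x) = -x := by simpa using LinearMap.congr_fun hsq₁ x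
  have s₂ (x : V) : I₂ (I₂ x) = -x := by simpa using LinearMap.congr_fun hsq₂ x
  have s₃ (x : V) : I₃ (I₃ x) = -x := by simpa using LinearMap.congr_fun hsq₃ x
  have b₁ (x : V) : ω₂ (I₁ x) = -ω₃ x := by rw [← a₁, s₁, map_neg]
  have b₂ (x : V) : ω₃ (I₂ x) = -ω₁ x := by rw [← a₂, s₂, map_neg]
  have b₃ (x : V) : ω₁ (I₃ x) = -ω₂ x := by rw [← a₃, s₃, map_neg]
  have c₁ (x : V) : I₃ (I₂ x) = -I₁ x := ω₂.injective (by rw [a₃, a₂, map_neg, b₁, neg_neg])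
  have c₂ (x : V) : I₁ (I₃ x) = -I₂ x := ω₃.injective (by rw [a₁, a₃, map_neg, b₂, neg_neg])
  have d₂ (x : V) : I₃ (I₁ x) = I₂ x := by
    rw [← neg_neg (I₁ x), ← c₁, map_neg, s₃, neg_neg]
  have d₃ (x : V) : I₁ (I₂ x) = I₃ x := by
    rw [← neg_neg (I₂ x), ← c₂, map_neg, s₁, neg_neg]
  have d₁ (x : V) : I₂ (I₃ x) = I₁ x := by
    apply ω₁.injective
    rw [a₂, ← d₃, a₁, ← neg_neg (I₁ x), ← c₁, map_neg, b₃, neg_neg]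
  refine ⟨?_, ?_, fun x y => ?_⟩
  · funext x y
    rw [hg₁, hg₂, ← h₁, ← h₂, ← a₃, d₂]
  · funext x y
    rw [hg₂, hg₃, ← h₂, ← h₃, ← a₁, d₃]
  · have e₂ (u v : V) : ω₁ (I₂ u) v = ω₁ u (I₂ v) := by
      rw [h₁ u, a₂, a₂, h₃]
    have e₃ (u v : V) : ω₁ (I₃ u) v = ω₁ u (I₃ v) := by
      rw [h₁ u, b₃, b₃, LinearMap.neg_apply, LinearMap.neg_apply, h₂]
    rw [hg₁, hg₁, ← h₁, ← neg_neg (I₁ y), ← c₁, map_neg, LinearMap.neg_apply, e₃, e₂, d₁]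
end

section
/- Let V be a module over ℝ, let ω₁, ω₂, ω₃ : V →ₗ[ℝ] V* and g : V →ₗ[ℝ] V* be linear maps to the dual, and let I₁, I₂, I₃ : V →ₗ[ℝ] V be endomorphisms satisfying ωᵢ ∘ Iⱼ = ∑ₖ ε_{ijk} ωₖ − δ_{ij} g for all i, j ∈ {1,2,3}, where ε_{ijk} is the totally antisymmetric Levi-Civita symbol with ε₁₂₃ = 1 and δ_{ij} is the Kronecker delta. Let R be a real 3×3 matrix with Rᵀ * R = 1 and det R = 1. Then the rotated maps ω'ᵢ := ∑ⱼ R_{ij} • ωⱼ and I'ᵢ := ∑ⱼ R_{ij} • Iⱼ satisfy the same relation with the same g: ω'ᵢ ∘ I'ⱼ = ∑ₖ ε_{ijk} ω'ₖ − δ_{ij} g for all i, j ∈ {1,2,3}. -/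
/-- The Levi-Civita symbol on `Fin 3`, with `ε 0 1 2 = 1`
(indices `0,1,2` playing the role of `1,2,3`). -/
noncomputable def leviCivita (i j k : Fin 3) : ℝ :=
  ((j : ℝ) - (i : ℝ)) * ((k : ℝ) - (i : ℝ)) * ((k : ℝ) - (j : ℝ)) / 2

/-- A special orthogonal `3 × 3` matrix preserves the Levi-Civita symbol. -/
theorem sum_mul_leviCivita_of_specialOrthogonal {R : Matrix (Fin 3) (Fin 3) ℝ}
    (hR : R.transpose * R = 1) (hdet : R.det = 1) (i j c : Fin 3) :
    ∑ a, ∑ b, R i a * R j b * leviCivita a b c = ∑ k, leviCivita i j k * R k c := by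
  have hadj : R.adjugate = R.transpose := by
    have h := R.mul_adjugate
    rw [hdet, one_smul] at h
    calc R.adjugate = R.transpose * R * R.adjugate := by rw [hR, one_mul]
      _ = R.transpose := by rw [mul_assoc, h, mul_one]
  have hcof (a b : Fin 3) : R b a = R.adjugate a b := by rw [hadj, Matrix.transpose_apply]
  simp only [hcof c 0, hcof c 1, hcof c 2, Matrix.adjugate_fin_three, Fin.sum_univ_three]
  fin_cases i <;> fin_cases j <;> fin_cases c <;> simp [leviCivita] <;> ring

/-- The rows of an orthogonal matrix are orthonormal. -/
theorem sum_mul_eq_ite_of_transpose_mul_self {R : Matrix (Fin 3) (Fin 3) ℝ}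
    (hR : R.transpose * R = 1) (i j : Fin 3) :
    ∑ a, R i a * R j a = if i = j then 1 else 0 := by
  have h := congrArg (fun M : Matrix (Fin 3) (Fin 3) ℝ => M i j) (mul_eq_one_comm.mp hR)
  simpa only [Matrix.mul_apply, Matrix.transpose_apply, Matrix.one_apply] using h

/-- Invariance of the relation `ωᵢ ∘ Iⱼ = ∑ₖ ε_{ijk} ωₖ − δ_{ij} g` under `SO(3)`, for linear maps
with values in an arbitrary real vector space. -/
theorem rotate_comp_rotate {V U : Type*} [AddCommGroup V] [Module ℝ V]
    [AddCommGroup U] [Module ℝ U]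
    (ω : Fin 3 → (V →ₗ[ℝ] U))
    (g : V →ₗ[ℝ] U)
    (I : Fin 3 → (V →ₗ[ℝ] V))
    (hrel : ∀ i j : Fin 3,
      (ω i) ∘ₗ (I j) =
        (∑ k : Fin 3, leviCivita i j k • ω k) - (if i = j then (1:ℝ) else 0) • g)
    (R : Matrix (Fin 3) (Fin 3) ℝ)
    (hR : R.transpose * R = 1) (hdet : R.det = 1) :
    ∀ i j : Fin 3,
      (∑ i' : Fin 3, R i i' • ω i') ∘ₗ (∑ j' : Fin 3, R j j' • I j') =
        (∑ k : Fin 3, leviCivita i j k • (∑ k' : Fin 3, R k k' • ω k')) -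
          (if i = j then (1:ℝ) else 0) • g := by
  intro i j
  have hω : ∑ a, ∑ b, (R i a * R j b) • ∑ c, leviCivita a b c • ω c =
      ∑ k, leviCivita i j k • ∑ c, R k c • ω c := by
    calc _ = ∑ c, (∑ a, ∑ b, R i a * R j b * leviCivita a b c) • ω c := by
          simp only [Fin.sum_univ_three]
          module
      _ = _ := by
          simp only [sum_mul_leviCivita_of_specialOrthogonal hR hdet, Finset.smul_sum,
            Finset.sum_smul, smul_smul]
          exact Finset.sum_comm
  have hg : ∑ a, ∑ b, (R i a * R j b) • (if a = b then (1 : ℝ) else 0) • g =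
      (if i = j then (1 : ℝ) else 0) • g := by
    rw [← sum_mul_eq_ite_of_transpose_mul_self hR i j]
    simp [Finset.sum_smul, ite_smul, smul_ite]
  calc _ = ∑ a, ∑ b, (R i a * R j b) • (ω a ∘ₗ I b) := by
        ext v
        simp [Finset.smul_sum, smul_smul]
    _ = _ := by
        rw [← hω, ← hg]
        simp only [hrel, smul_sub, Finset.sum_sub_distrib]

/-- the algebraic relation `ωᵢ ∘ Iⱼ = ∑ₖ ε_{ijk} ωₖ − δ_{ij} g` is
invariant under a simultaneous `SO(3)` rotation of the `ωᵢ` and the `Iᵢ`,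
with the same `g`. -/
theorem stmt2 {V : Type*} [AddCommGroup V] [Module ℝ V]
    (ω : Fin 3 → (V →ₗ[ℝ] Module.Dual ℝ V))
    (g : V →ₗ[ℝ] Module.Dual ℝ V)
    (I : Fin 3 → (V →ₗ[ℝ] V))
    (hrel : ∀ i j : Fin 3,
      (ω i) ∘ₗ (I j) =
        (∑ k : Fin 3, leviCivita i j k • ω k) - (if i = j then (1:ℝ) else 0) • g)
    (R : Matrix (Fin 3) (Fin 3) ℝ)
    (hR : R.transpose * R = 1) (hdet : R.det = 1) :
    ∀ i j : Fin 3,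
      (∑ i' : Fin 3, R i i' • ω i') ∘ₗ (∑ j' : Fin 3, R j j' • I j') =
        (∑ k : Fin 3, leviCivita i j k • (∑ k' : Fin 3, R k k' • ω k')) -
          (if i = j then (1:ℝ) else 0) • g :=
  rotate_comp_rotate (U := Module.Dual ℝ V) ω g I hrel R hR hdet
end

section
/- Let f be a smooth real-valued function on an open set S ⊆ C. Then at every point of S: ∑_{I,J} (x⃗^I · x⃗^J)(∇_I · ∇_J f) + ∑_{I,J} (x⃗^I × x⃗^J) · (∇_I × ∇_J f) = ∑_{i=1}^{3} L_i(L_i f) + L₀(L₀ f) + L₀ f, where ∇_I · ∇_J f = ∑_i ∂_{I,i}∂_{J,i} f and (∇_I × ∇_J f)_k = ∑_{i,j} ε_{kij} ∂_{I,i}∂_{J,j} f. -/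
/-- The configuration space of `m` points in `ℝ³`. -/
abbrev Conf (m : ℕ) := Fin m → Fin 3 → ℝ

/-- Standard basis vector `e_{K,i}` of the configuration space. -/
noncomputable def e {m : ℕ} (K : Fin m) (i : Fin 3) : Conf m :=
  Pi.single K (Pi.single i 1)

/-- The partial derivative `∂_{K,i}` along the basis vector `e_{K,i}`. -/
noncomputable def pd {m : ℕ} (K : Fin m) (i : Fin 3) (f : Conf m → ℝ) : Conf m → ℝ :=
  fun x => fderiv ℝ f x (e K i)

/-- Standard dot product on `ℝ³`. -/
noncomputable def dot3 (a b : Fin 3 → ℝ) : ℝ := ∑ i, a i * b i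

/-- The Levi-Civita symbol on `Fin 3`, with `ε 0 1 2 = 1`. -/
noncomputable def eps (k i j : Fin 3) : ℝ :=
  ((i : ℝ) - (k : ℝ)) * ((j : ℝ) - (k : ℝ)) * ((j : ℝ) - (i : ℝ)) / 2

/-- Standard cross product on `ℝ³`: `(a × b)_k = ∑_{i,j} ε_{kij} aᵢ bⱼ`. -/
noncomputable def cross3 (a b : Fin 3 → ℝ) : Fin 3 → ℝ :=
  fun k => ∑ i, ∑ j, eps k i j * a i * b j

/-- `∇_K f` : the `ℝ³`-valued gradient with respect to the `K`-th point. -/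
noncomputable def grad {m : ℕ} (K : Fin m) (f : Conf m → ℝ) : Conf m → Fin 3 → ℝ :=
  fun x i => pd K i f x

/-- The generator of simultaneous scalings: `L₀ f = ∑_K x⃗^K · ∇_K f`. -/
noncomputable def L0 {m : ℕ} (f : Conf m → ℝ) : Conf m → ℝ :=
  fun x => ∑ K, dot3 (x K) (grad K f x)

/-- The generators of rigid rotations: `Lᵢ f = −∑_K (x⃗^K × ∇_K f)ᵢ`,
for `i = 0, 1, 2` (playing the role of `1, 2, 3`). -/
noncomputable def Lrot {m : ℕ} (i : Fin 3) (f : Conf m → ℝ) : Conf m → ℝ :=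
  fun x => -∑ K, cross3 (x K) (grad K f x) i

/-- The first-order operator `∑_K ∑_{a,b} c_{ab} x^K_a ∂_{K,b}`. -/
noncomputable def linVec {m : ℕ} (c : Fin 3 → Fin 3 → ℝ) (f : Conf m → ℝ) : Conf m → ℝ :=
  fun x => ∑ K, ∑ a, ∑ b, c a b * (x K a * pd K b f x)

theorem L0_eq_linVec {m : ℕ} (f : Conf m → ℝ) :
    L0 f = linVec (fun a b => if a = b then 1 else 0) f := by
  funext x
  simp [L0, linVec, dot3, grad]

theorem Lrot_eq_linVec {m : ℕ} (i : Fin 3) (f : Conf m → ℝ) :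
    Lrot i f = linVec (fun a b => -eps i a b) f := by
  funext x
  simp [Lrot, linVec, cross3, grad, mul_assoc]

theorem differentiableAt_pd {m : ℕ} {f : Conf m → ℝ} {x : Conf m}
    (hf : ContDiffAt ℝ 2 f x) (K : Fin m) (i : Fin 3) :
    DifferentiableAt ℝ (pd K i f) x := by
  have h : ContDiffAt ℝ 1 (fderiv ℝ f) x := hf.fderiv_right (by norm_num)
  exact (h.differentiableAt (by norm_num)).clm_apply (differentiableAt_const _)

theorem pd_linVec {m : ℕ} (c : Fin 3 → Fin 3 → ℝ) {f : Conf m → ℝ} {x : Conf m}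
    (hf : ContDiffAt ℝ 2 f x) (I : Fin m) (i : Fin 3) :
    pd I i (linVec c f) x =
      (∑ b, c i b * pd I b f x) +
        ∑ J, ∑ a, ∑ b, c a b * (x J a * pd I i (pd J b f) x) := by
  have hcoord (K : Fin m) (a : Fin 3) : HasFDerivAt (fun y : Conf m => y K a)
      ((ContinuousLinearMap.proj (R := ℝ) (φ := fun _ : Fin 3 => ℝ) a).comp
        (ContinuousLinearMap.proj (R := ℝ) (φ := fun _ : Fin m => Fin 3 → ℝ) K)) x :=
    ((ContinuousLinearMap.proj (R := ℝ) (φ := fun _ : Fin 3 => ℝ) a).comp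
      (ContinuousLinearMap.proj (R := ℝ) (φ := fun _ : Fin m => Fin 3 → ℝ) K)).hasFDerivAt
  have h : HasFDerivAt (linVec c f) _ x :=
    HasFDerivAt.fun_sum fun K _ => HasFDerivAt.fun_sum fun a _ => HasFDerivAt.fun_sum fun b _ =>
      ((hcoord K a).mul (differentiableAt_pd hf K b).hasFDerivAt).const_mul (c a b)
  have hsingle (K : Fin m) (a : Fin 3) :
      (e I i : Conf m) K a = if K = I then (if a = i then 1 else 0) else 0 := by
    by_cases hK : K = I
    · subst hK
      simp [e, Pi.single_apply]
    · simp [e, hK]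
  rw [pd, h.fderiv]
  simp only [sum_apply, smul_apply,
    add_apply, ContinuousLinearMap.comp_apply,
    ContinuousLinearMap.proj_apply, hsingle, smul_eq_mul, mul_add, Finset.sum_add_distrib]
  rw [add_comm]
  congr 1
  simp

theorem linVec_linVec {m : ℕ} (c d : Fin 3 → Fin 3 → ℝ) {f : Conf m → ℝ} {x : Conf m}
    (hf : ContDiffAt ℝ 2 f x) :
    linVec c (linVec d f) x =
      (∑ I, ∑ a, ∑ b, ∑ b', c a b * d b b' * (x I a * pd I b' f x)) +
        ∑ I, ∑ J, ∑ a, ∑ b, ∑ a', ∑ b',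
          c a b * d a' b' * (x I a * x J a' * pd I b (pd J b' f) x) := by
  rw [linVec, ← Finset.sum_add_distrib]
  refine Finset.sum_congr rfl fun I _ => ?_
  simp only [pd_linVec d hf, mul_add, Finset.sum_add_distrib]
  congr 1
  · simp only [Finset.mul_sum]
    refine Finset.sum_congr rfl fun a _ => Finset.sum_congr rfl fun b _ =>
      Finset.sum_congr rfl fun b' _ => ?_
    ring
  · rw [Finset.sum_comm (s := (Finset.univ : Finset (Fin m)))]
    refine Finset.sum_congr rfl fun a _ => ?_
    rw [Finset.sum_comm (s := (Finset.univ : Finset (Fin m)))]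
    refine Finset.sum_congr rfl fun b _ => ?_
    simp only [Finset.mul_sum]
    refine Finset.sum_congr rfl fun J _ => Finset.sum_congr rfl fun a' _ =>
      Finset.sum_congr rfl fun b' _ => ?_
    ring

/-- the operator identity
`∑_{I,J} (x⃗^I · x⃗^J)(∇_I · ∇_J f) + ∑_{I,J} (x⃗^I × x⃗^J) · (∇_I × ∇_J f)
  = ∑ᵢ Lᵢ(Lᵢ f) + L₀(L₀ f) + L₀ f`. -/
theorem stmt5 {m : ℕ} (hm : 1 ≤ m) (S : Set (Conf m)) (hS : IsOpen S)
    (f : Conf m → ℝ) (hf : ContDiffOn ℝ (⊤ : ℕ∞) f S) :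
    ∀ x ∈ S,
      (∑ I : Fin m, ∑ J : Fin m, dot3 (x I) (x J) * (∑ i : Fin 3, pd I i (pd J i f) x))
        + (∑ I : Fin m, ∑ J : Fin m, dot3 (cross3 (x I) (x J))
            (fun k => ∑ i : Fin 3, ∑ j : Fin 3, eps k i j * pd I i (pd J j f) x))
      = (∑ i : Fin 3, Lrot i (Lrot i f) x) + L0 (L0 f) x + L0 f x := by
  intro x hx
  have hfx : ContDiffAt ℝ 2 f x :=
    (hf.contDiffAt (hS.mem_nhds hx)).of_le (WithTop.coe_le_coe.2 (le_top : (2 : ℕ∞) ≤ ⊤))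
  simp only [L0_eq_linVec, Lrot_eq_linVec, linVec_linVec _ _ hfx, Finset.sum_add_distrib]
  have cancel : ∀ A B C D E F : ℝ, A + D + F = 0 → C = B + E → C = A + B + (D + E) + F := by
    intros
    linarith
  apply cancel
  · rw [Finset.sum_comm, linVec, ← Finset.sum_add_distrib, ← Finset.sum_add_distrib]
    refine Finset.sum_eq_zero fun I _ => ?_
    simp [Fin.sum_univ_three, eps]
    ring
  · rw [Finset.sum_comm (s := (Finset.univ : Finset (Fin 3))) (t := (Finset.univ : Finset (Fin m))),
      ← Finset.sum_add_distrib, ← Finset.sum_add_distrib]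
    refine Finset.sum_congr rfl fun I _ => ?_
    rw [Finset.sum_comm (s := (Finset.univ : Finset (Fin 3))) (t := (Finset.univ : Finset (Fin m))),
      ← Finset.sum_add_distrib, ← Finset.sum_add_distrib]
    refine Finset.sum_congr rfl fun J _ => ?_
    simp [Fin.sum_univ_three, eps, dot3, cross3]
    ring
end

section
/- Let U_{IJ} (I, J ∈ Fin m) be smooth real-valued functions on an open set S ⊆ C with U_{IJ} = U_{JI}, satisfying for all I, J, K: (i) ∇_I U_{KJ} = ∇_J U_{KI} (equality of ℝ³-valued gradients), (ii) ∑_K x⃗^K × ∇_K U_{IJ} = 0⃗, and (iii) ∑_K x⃗^K · ∇_K U_{IJ} = −U_{IJ}. Define U := 2 ∑_{I,J} U_{IJ} (x⃗^I · x⃗^J) on S. Then at every point of S: (1) ∇_I U = 2 ∑_J U_{IJ} x⃗^J for all I; (2) ∇_I × ∇_J U = 0⃗ for all I, J (i.e. ∑_{i,j} ε_{kij} ∂_{I,i}∂_{J,j} U = 0 for each k); (3) ∑_K x⃗^K × ∇_K U = 0⃗; (4) ∑_K x⃗^K · ∇_K U = U; and (5) U_{IJ} = ¼ ∇_I · ∇_J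 U for all I, J. -/
theorem pd_mul {m : ℕ} {f g : Conf m → ℝ} {x : Conf m} (hf : DifferentiableAt ℝ f x)
    (hg : DifferentiableAt ℝ g x) (K : Fin m) (i : Fin 3) :
    pd K i (fun y => f y * g y) x = f x * pd K i g x + pd K i f x * g x := by
  simp [pd, fderiv_fun_mul hf hg, mul_comm (g x)]

theorem pd_const_mul {m : ℕ} {f : Conf m → ℝ} {x : Conf m} (hf : DifferentiableAt ℝ f x)
    (c : ℝ) (K : Fin m) (i : Fin 3) :
    pd K i (fun y => c * f y) x = c * pd K i f x := by
  simp [pd, fderiv_const_mul hf]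

theorem pd_sum {m : ℕ} {ι : Type*} (s : Finset ι) {f : ι → Conf m → ℝ} {x : Conf m}
    (hf : ∀ a ∈ s, DifferentiableAt ℝ (f a) x) (K : Fin m) (i : Fin 3) :
    pd K i (fun y => ∑ a ∈ s, f a y) x = ∑ a ∈ s, pd K i (f a) x := by
  simp [pd, fderiv_fun_sum hf]

theorem differentiableAt_coord {m : ℕ} (J : Fin m) (j : Fin 3) (x : Conf m) :
    DifferentiableAt ℝ (fun y : Conf m => y J j) x := by
  fun_prop

theorem pd_coord {m : ℕ} (K J : Fin m) (i j : Fin 3) (x : Conf m) :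
    pd K i (fun y => y J j) x = if J = K then (if j = i then 1 else 0) else 0 := by
  have h : HasFDerivAt (fun y : Conf m => y J j)
      ((ContinuousLinearMap.proj (R := ℝ) (φ := fun _ : Fin 3 => ℝ) j).comp
        (ContinuousLinearMap.proj (R := ℝ) (φ := fun _ : Fin m => Fin 3 → ℝ) J)) x :=
    ((ContinuousLinearMap.proj (R := ℝ) (φ := fun _ : Fin 3 => ℝ) j).comp
      (ContinuousLinearMap.proj (R := ℝ) (φ := fun _ : Fin m => Fin 3 → ℝ) J)).hasFDerivAt
  rw [pd, h.fderiv]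
  by_cases hJ : J = K
  · subst hJ
    simp [e, Pi.single_apply]
  · simp [e, hJ]

theorem differentiableAt_dot3 {m : ℕ} (J K : Fin m) (x : Conf m) :
    DifferentiableAt ℝ (fun y : Conf m => dot3 (y J) (y K)) x := by
  unfold dot3
  fun_prop

theorem pd_dot3 {m : ℕ} (I J K : Fin m) (i : Fin 3) (x : Conf m) :
    pd I i (fun y => dot3 (y J) (y K)) x
      = (if J = I then x K i else 0) + (if K = I then x J i else 0) := by
  unfold dot3
  rw [pd_sum _ fun a _ => (differentiableAt_coord J a x).fun_mul (differentiableAt_coord K a x)]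
  simp_rw [pd_mul (differentiableAt_coord J _ x) (differentiableAt_coord K _ x), pd_coord,
    Finset.sum_add_distrib]
  split_ifs <;> simp [add_comm]

theorem eps_swap (k i j : Fin 3) : eps k i j = -eps k j i := by
  unfold eps
  ring

theorem sum_eps_mul_eq_zero_of_symm {A : Fin 3 → Fin 3 → ℝ} (hA : ∀ i j, A i j = A j i)
    (k : Fin 3) : ∑ i, ∑ j, eps k i j * A i j = 0 := by
  have h : ∑ i, ∑ j, eps k i j * A i j = -∑ i, ∑ j, eps k i j * A i j := by
    conv_lhs => rw [Finset.sum_comm]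
    simp_rw [← Finset.sum_neg_distrib]
    refine Finset.sum_congr rfl fun i _ => Finset.sum_congr rfl fun j _ => ?_
    rw [eps_swap, hA j i, neg_mul]
  linarith

theorem symm_of_sum_eps_mul_eq_zero {A : Fin 3 → Fin 3 → ℝ}
    (hA : ∀ k, ∑ i, ∑ j, eps k i j * A i j = 0) (i j : Fin 3) : A i j = A j i := by
  have h0 := hA 0
  have h1 := hA 1
  have h2 := hA 2
  simp only [Fin.sum_univ_three, eps, Fin.val_zero, Fin.val_one, Fin.val_two] at h0 h1 h2
  norm_num at h0 h1 h2
  fin_cases i <;> fin_cases j <;> simp <;> linarith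

theorem sum_cross3_apply {m : ℕ} (v w : Fin m → Fin 3 → ℝ) (k : Fin 3) :
    ∑ K, cross3 (v K) (w K) k = ∑ i, ∑ j, eps k i j * ∑ K, v K i * w K j := by
  simp_rw [cross3, Finset.mul_sum, mul_assoc]
  rw [Finset.sum_comm]
  exact Finset.sum_congr rfl fun i _ => Finset.sum_comm

/-- from a symmetric Higgs field `U_{IJ}` satisfying the first
Bogomolny-type integrability equations and the hyperkähler-cone symmetry
constraints, the potential `U = 2 ∑ U_{IJ} (x⃗^I · x⃗^J)` satisfies the dual set
of conditions, and reproduces the Higgs field via `U_{IJ} = ¼ ∇_I · ∇_J U`. -/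
theorem stmt6 {m : ℕ} (hm : 1 ≤ m) (S : Set (Conf m)) (hS : IsOpen S)
    (U : Fin m → Fin m → Conf m → ℝ)
    (hsmooth : ∀ I J, ContDiffOn ℝ (⊤ : ℕ∞) (U I J) S)
    (hsymm : ∀ I J, U I J = U J I)
    (h1 : ∀ I J K : Fin m, ∀ x ∈ S, ∀ i : Fin 3,
      pd I i (U K J) x = pd J i (U K I) x)
    (h2 : ∀ I J : Fin m, ∀ x ∈ S, ∀ k : Fin 3,
      ∑ K : Fin m, cross3 (x K) (grad K (U I J) x) k = 0)
    (h3 : ∀ I J : Fin m, ∀ x ∈ S,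
      ∑ K : Fin m, dot3 (x K) (grad K (U I J) x) = -(U I J x))
    (Ubig : Conf m → ℝ)
    (hUbig : Ubig = fun x => 2 * ∑ I : Fin m, ∑ J : Fin m, U I J x * dot3 (x I) (x J)) :
    ∀ x ∈ S,
      (∀ I : Fin m, ∀ i : Fin 3, pd I i Ubig x = 2 * ∑ J : Fin m, U I J x * x J i) ∧
      (∀ I J : Fin m, ∀ k : Fin 3,
        ∑ i : Fin 3, ∑ j : Fin 3, eps k i j * pd I i (pd J j Ubig) x = 0) ∧
      (∀ k : Fin 3, ∑ K : Fin m, cross3 (x K) (grad K Ubig x) k = 0) ∧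
      (∑ K : Fin m, dot3 (x K) (grad K Ubig x) = Ubig x) ∧
      (∀ I J : Fin m,
        U I J x = (1/4) * ∑ i : Fin 3, pd I i (pd J i Ubig) x) := by
  have hd : ∀ I J, ∀ x ∈ S, DifferentiableAt ℝ (U I J) x := fun I J x hx =>
    ((hsmooth I J).contDiffAt (hS.mem_nhds hx)).differentiableAt (by simp)
  have hrot : ∀ I J, ∀ x ∈ S, ∀ i j : Fin 3,
      ∑ K, x K i * pd K j (U I J) x = ∑ K, x K j * pd K i (U I J) x := by
    intro I J x hx i j
    refine symm_of_sum_eps_mul_eq_zero (A := fun i j => ∑ K, x K i * pd K j (U I J) x)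
      (fun k => ?_) i j
    have h := h2 I J x hx k
    rwa [sum_cross3_apply x (fun K => grad K (U I J) x)] at h
  have hgrad : ∀ x ∈ S, ∀ I : Fin m, ∀ i : Fin 3,
      pd I i Ubig x = 2 * ∑ J : Fin m, U I J x * x J i := by
    intro x hx I i
    have hUd : ∀ J K, DifferentiableAt ℝ (fun y => U J K y * dot3 (y J) (y K)) x := fun J K =>
      (hd J K x hx).mul (differentiableAt_dot3 J K x)
    have hcontr : ∑ J, ∑ K, pd I i (U J K) x * dot3 (x J) (x K) = -∑ J, U I J x * x J i := by
      calc ∑ J, ∑ K, pd I i (U J K) x * dot3 (x J) (x K)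
          = ∑ J, ∑ a, x J a * ∑ K, x K a * pd K i (U J I) x := by
            refine Finset.sum_congr rfl fun J _ => ?_
            simp_rw [Finset.mul_sum]
            rw [Finset.sum_comm]
            refine Finset.sum_congr rfl fun K _ => ?_
            rw [h1 I K J x hx i, dot3, Finset.mul_sum]
            exact Finset.sum_congr rfl fun a _ => by ring
        _ = ∑ J, ∑ a, x J a * ∑ K, x K i * pd J a (U I K) x := by
            refine Finset.sum_congr rfl fun J _ => Finset.sum_congr rfl fun a _ => ?_
            rw [hrot J I x hx a i]
            refine congrArg _ (Finset.sum_congr rfl fun K _ => ?_)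
            rw [hsymm J I, h1 K J I x hx a]
        _ = ∑ K, x K i * ∑ J, dot3 (x J) (grad J (U I K) x) := by
            simp_rw [dot3, grad, Finset.mul_sum]
            conv_rhs => rw [Finset.sum_comm]
            refine Finset.sum_congr rfl fun J _ => ?_
            rw [Finset.sum_comm]
            refine Finset.sum_congr rfl fun K _ => Finset.sum_congr rfl fun a _ => ?_
            ring
        _ = -∑ J, U I J x * x J i := by
            simp_rw [h3 I _ x hx]
            rw [← Finset.sum_neg_distrib]
            exact Finset.sum_congr rfl fun J _ => by ring
    rw [hUbig, pd_const_mul (DifferentiableAt.fun_sum fun J _ =>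
        DifferentiableAt.fun_sum fun K _ => hUd J K),
      pd_sum _ fun J _ => DifferentiableAt.fun_sum fun K _ => hUd J K]
    simp_rw [pd_sum _ fun K _ => hUd _ K,
      pd_mul (hd _ _ x hx) (differentiableAt_dot3 _ _ x), pd_dot3, Finset.sum_add_distrib,
      hcontr, mul_add, Finset.sum_add_distrib, mul_ite, mul_zero]
    rw [Finset.sum_comm (f := fun J K => if J = I then U J K x * x K i else 0)]
    simp only [Finset.sum_ite_eq', Finset.mem_univ, if_true]
    simp_rw [fun J => hsymm J I]
    ring
  have hhess : ∀ x ∈ S, ∀ I J : Fin m, ∀ i j : Fin 3, pd I i (pd J j Ubig) x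
      = 2 * (∑ K, x K j * pd K i (U J I) x + if j = i then U J I x else 0) := by
    intro x hx I J i j
    have hev : pd J j Ubig =ᶠ[nhds x] fun y => 2 * ∑ K, U J K y * y K j :=
      Filter.eventuallyEq_of_mem (hS.mem_nhds hx) fun y hy => hgrad y hy J j
    have hUd : ∀ K, DifferentiableAt ℝ (fun y => U J K y * y K j) x := fun K =>
      (hd J K x hx).mul (differentiableAt_coord K j x)
    rw [pd, hev.fderiv_eq, ← pd, pd_const_mul (DifferentiableAt.fun_sum fun K _ => hUd K),
      pd_sum _ fun K _ => hUd K]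
    simp_rw [pd_mul (hd J _ x hx) (differentiableAt_coord _ j x), pd_coord, h1 I _ J x hx i,
      Finset.sum_add_distrib, mul_ite, mul_zero, mul_one]
    simp only [Finset.sum_ite_eq', Finset.mem_univ, if_true]
    simp_rw [mul_comm (pd _ _ _ _)]
    ring
  intro x hx
  refine ⟨hgrad x hx, fun I J k => ?_, fun k => ?_, ?_, fun I J => ?_⟩
  · refine sum_eps_mul_eq_zero_of_symm (A := fun i j => pd I i (pd J j Ubig) x)
      (fun i j => ?_) k
    simp only [hhess x hx, hrot J I x hx j i]
    by_cases hij : i = j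
    · simp [hij]
    · simp [hij, Ne.symm hij]
  · rw [sum_cross3_apply x (fun K => grad K Ubig x)]
    refine sum_eps_mul_eq_zero_of_symm (A := fun i j => ∑ K, x K i * grad K Ubig x j)
      (fun i j => ?_) k
    simp_rw [grad, hgrad x hx, Finset.mul_sum]
    rw [Finset.sum_comm]
    refine Finset.sum_congr rfl fun J _ => Finset.sum_congr rfl fun K _ => ?_
    rw [hsymm K J]
    ring
  · rw [congrFun hUbig x]
    simp_rw [dot3, grad, hgrad x hx, Finset.mul_sum]
    refine Finset.sum_congr rfl fun J _ => ?_
    rw [Finset.sum_comm]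
    refine Finset.sum_congr rfl fun K _ => Finset.sum_congr rfl fun a _ => ?_
    ring
  · have h := h3 J I x hx
    simp_rw [dot3, grad] at h
    rw [Finset.sum_comm] at h
    simp_rw [hhess x hx, if_true, ← Finset.mul_sum, Finset.sum_add_distrib, h]
    simp [hsymm I J]
    ring
end

section
/- Let L be a smooth real-valued function on an open set S ⊆ C satisfying the Lindström–Roček constraints ∇_I · ∇_J L = 0 and ∇_I × ∇_J L = 0⃗ for all I, J ∈ Fin m. Then at every point of S and for every I ∈ Fin m the following complex identities hold: (L₁ + iL₀)(∂_{I,1} L) = −(L₂ − iL₃)(∂_{z̄^I} L) and (L₂ + iL₃)(∂_{I,1} L) = (L₁ − iL₀)(∂_{z̄^I} L), where ∂_{z̄^I} L := ∂_{I,2} L + i ∂_{I,3} L and all operators are extended ℂ-linearly to complex-valued functions. -/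
/-- Complex-valued partial derivative `∂_{K,i}` (the ℂ-linear extension). -/
noncomputable def pdC {m : ℕ} (K : Fin m) (i : Fin 3) (f : Conf m → ℂ) : Conf m → ℂ :=
  fun x => fderiv ℝ f x (e K i)

/-- The ℂ-linear extension of the scaling generator `L₀`. -/
noncomputable def L0C {m : ℕ} (f : Conf m → ℂ) : Conf m → ℂ :=
  fun x => ∑ K, ∑ i, (x K i : ℂ) * pdC K i f x

/-- The ℂ-linear extension of the rotation generators `Lᵢ`. -/
noncomputable def LrotC {m : ℕ} (k : Fin 3) (f : Conf m → ℂ) : Conf m → ℂ :=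
  fun x => -∑ K, ∑ i, ∑ j, (eps k i j : ℂ) * (x K i : ℂ) * pdC K j f x

theorem ContDiffOn.differentiableAt_pd {m : ℕ} {S : Set (Conf m)} (hS : IsOpen S)
    {L : Conf m → ℝ} (hL : ContDiffOn ℝ (⊤ : ℕ∞) L S) (J : Fin m) (j : Fin 3)
    {x : Conf m} (hx : x ∈ S) : DifferentiableAt ℝ (pd J j L) x := by
  have h : DifferentiableAt ℝ (fderiv ℝ L) x :=
    ((hL.fderiv_of_isOpen (m := 1) hS (by norm_cast)).differentiableOn
      one_ne_zero).differentiableAt (hS.mem_nhds hx)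
  exact h.clm_apply (differentiableAt_const _)

theorem pdC_ofReal {m : ℕ} (K : Fin m) (i : Fin 3) {f : Conf m → ℝ} {x : Conf m}
    (hf : DifferentiableAt ℝ f x) : pdC K i (fun y => (f y : ℂ)) x = (pd K i f x : ℂ) := by
  have h := Complex.ofRealCLM.hasFDerivAt.comp x hf.hasFDerivAt
  exact congrArg (· (e K i)) h.fderiv

theorem pdC_congr {m : ℕ} (K : Fin m) (i : Fin 3) {f g : Conf m → ℂ} {x : Conf m}
    (h : f =ᶠ[nhds x] g) : pdC K i f x = pdC K i g x := by
  simp only [pdC, h.fderiv_eq]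

theorem pdC_add_I_mul {m : ℕ} (K : Fin m) (i : Fin 3) {f g : Conf m → ℝ} {x : Conf m}
    (hf : DifferentiableAt ℝ f x) (hg : DifferentiableAt ℝ g x) :
    pdC K i (fun y => (f y : ℂ) + Complex.I * (g y : ℂ)) x =
      (pd K i f x : ℂ) + Complex.I * (pd K i g x : ℂ) := by
  have hf' := Complex.ofRealCLM.hasFDerivAt.comp x hf.hasFDerivAt
  have hg' := (Complex.ofRealCLM.hasFDerivAt.comp x hg.hasFDerivAt).const_mul Complex.I
  exact congrArg (· (e K i)) (hf'.add hg').fderiv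

/-- for an `L`-potential satisfying the Lindström–Roček
constraints, the first derivatives satisfy the complex identities
`(L₁ + iL₀)(∂_{I,1}L) = −(L₂ − iL₃)(∂_{z̄^I}L)` and
`(L₂ + iL₃)(∂_{I,1}L) = (L₁ − iL₀)(∂_{z̄^I}L)`
(indices `1,2,3` of the paper correspond to `0,1,2` in `Fin 3`). -/
theorem stmt8 {m : ℕ} (hm : 1 ≤ m) (S : Set (Conf m)) (hS : IsOpen S)
    (L : Conf m → ℝ) (hsmooth : ContDiffOn ℝ (⊤ : ℕ∞) L S)
    (hLap : ∀ I J : Fin m, ∀ x ∈ S, ∑ i : Fin 3, pd I i (pd J i L) x = 0)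
    (hcurl : ∀ I J : Fin m, ∀ x ∈ S, ∀ k : Fin 3,
      ∑ i : Fin 3, ∑ j : Fin 3, eps k i j * pd I i (pd J j L) x = 0)
    (Lc : Conf m → ℂ) (hLc : Lc = fun x => (L x : ℂ)) :
    ∀ I : Fin m, ∀ x ∈ S,
      (LrotC 0 (pdC I 0 Lc) x + Complex.I * L0C (pdC I 0 Lc) x =
        -(LrotC 1 (fun y => pdC I 1 Lc y + Complex.I * pdC I 2 Lc y) x -
            Complex.I * LrotC 2 (fun y => pdC I 1 Lc y + Complex.I * pdC I 2 Lc y) x)) ∧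
      (LrotC 1 (pdC I 0 Lc) x + Complex.I * LrotC 2 (pdC I 0 Lc) x =
        LrotC 0 (fun y => pdC I 1 Lc y + Complex.I * pdC I 2 Lc y) x -
          Complex.I * L0C (fun y => pdC I 1 Lc y + Complex.I * pdC I 2 Lc y) x) := by
  subst hLc
  intro I x hx
  have hfst (j : Fin 3) :
      pdC I j (fun y => (L y : ℂ)) =ᶠ[nhds x] fun y => (pd I j L y : ℂ) := by
    filter_upwards [hS.mem_nhds hx] with y hy
    exact pdC_ofReal I j ((hsmooth.differentiableOn (by simp)).differentiableAt
      (hS.mem_nhds hy))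
  have hd (j : Fin 3) := ContDiffOn.differentiableAt_pd hS hsmooth I j hx
  have hone (K : Fin m) (i : Fin 3) :
      pdC K i (pdC I 0 fun y => (L y : ℂ)) x = (pd K i (pd I 0 L) x : ℂ) :=
    (pdC_congr K i (hfst 0)).trans (pdC_ofReal K i (hd 0))
  have hzbar (K : Fin m) (i : Fin 3) :
      pdC K i (fun y => pdC I 1 (fun y => (L y : ℂ)) y +
        Complex.I * pdC I 2 (fun y => (L y : ℂ)) y) x =
      (pd K i (pd I 1 L) x : ℂ) + Complex.I * (pd K i (pd I 2 L) x : ℂ) := by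
    refine (pdC_congr K i ?_).trans (pdC_add_I_mul K i (hd 1) (hd 2))
    filter_upwards [hfst 1, hfst 2] with y h1 h2
    rw [h1, h2]
  have htrace (K : Fin m) : (pd K 0 (pd I 0 L) x : ℂ) =
      -(pd K 1 (pd I 1 L) x : ℂ) - (pd K 2 (pd I 2 L) x : ℂ) := by
    have h := hLap K I x hx
    rw [Fin.sum_univ_three] at h
    exact_mod_cast (by linarith : pd K 0 (pd I 0 L) x =
      -pd K 1 (pd I 1 L) x - pd K 2 (pd I 2 L) x)
  have hsymm (K : Fin m) : pd K 2 (pd I 1 L) x = pd K 1 (pd I 2 L) x ∧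
      pd K 2 (pd I 0 L) x = pd K 0 (pd I 2 L) x ∧
      pd K 1 (pd I 0 L) x = pd K 0 (pd I 1 L) x := by
    have h0 := hcurl K I x hx 0
    have h1 := hcurl K I x hx 1
    have h2 := hcurl K I x hx 2
    norm_num [Fin.sum_univ_three, eps] at h0 h1 h2
    refine ⟨?_, ?_, ?_⟩ <;> linarith
  simp only [LrotC, L0C, hone, hzbar, Finset.mul_sum, ← Finset.sum_neg_distrib,
    ← Finset.sum_add_distrib, ← Finset.sum_sub_distrib]
  constructor <;> refine Finset.sum_congr rfl fun K _ => ?_ <;>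
  · obtain ⟨h21, h20, h10⟩ := hsymm K
    norm_num [Fin.sum_univ_three, eps, htrace K, h21, h20, h10]
    ring_nf
    simp only [Complex.I_sq]
    ring
end

section
/- Let F : (Fin n → ℂ) → ℂ be complex-differentiable everywhere and homogeneous of degree two: F(t • X) = t² · F(X) for all t ∈ ℂ and X ∈ Fin n → ℂ. Write F_A(X) for the partial derivative of F at X along the standard basis vector e_A, and F_{AB}(X) for the second partial derivatives. Then for every X: Im( ∑_A conj(X_A) · F_A(X) ) = ∑_{A,B} Im( F_{AB}(X) ) · Re( conj(X_A) · X_B ). -/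
open Filter Topology in
/-- An entire function `g` with `g t = t ^ 2 * h t⁻¹` for `t ≠ 0` and `h` continuous at `0`
is a polynomial of degree at most two. -/
theorem eq_quadratic_of_inv {g h : ℂ → ℂ} (hg : Differentiable ℂ g)
    (hh : ContinuousAt h 0) (hgh : ∀ t, t ≠ 0 → g t = t ^ 2 * h t⁻¹) (t : ℂ) :
    g t = g 0 + t * deriv g 0 + t ^ 2 * h 0 := by
  have dslope_diff : ∀ f : ℂ → ℂ, Differentiable ℂ f → Differentiable ℂ (dslope f 0) := by
    intro f hf
    rw [← differentiableOn_univ] at hf ⊢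
    exact (Complex.differentiableOn_dslope univ_mem).2 hf
  set k := dslope (dslope g 0) 0 with hk_def
  have hk : Differentiable ℂ k := dslope_diff _ (dslope_diff g hg)
  have expand : ∀ s, g s = g 0 + s * deriv g 0 + s ^ 2 * k s := by
    intro s
    have h₁ := sub_smul_dslope g 0 s
    have h₂ := sub_smul_dslope (dslope g 0) 0 s
    simp only [sub_zero, smul_eq_mul, dslope_same] at h₁ h₂
    rw [← hk_def] at h₂
    linear_combination (-1 : ℂ) * h₁ - s * h₂
  have hinv : Tendsto (fun s : ℂ => s⁻¹) (cocompact ℂ) (𝓝 0) := by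
    simpa only [Metric.cobounded_eq_cocompact] using tendsto_inv₀_cobounded (α := ℂ)
  have hlim : Tendsto (fun s : ℂ => h s⁻¹ - g 0 * s⁻¹ ^ 2 - deriv g 0 * s⁻¹) (cocompact ℂ)
      (𝓝 (h 0)) := by
    have := ((hh.tendsto.comp hinv).sub ((hinv.pow 2).const_mul (g 0))).sub
      (hinv.const_mul (deriv g 0))
    simpa using this
  have hk_lim : Tendsto k (cocompact ℂ) (𝓝 (h 0)) := by
    refine hlim.congr' ?_
    filter_upwards [(Set.finite_singleton (0 : ℂ)).isCompact.compl_mem_cocompact] with s hs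
    have hs : s ≠ 0 := hs
    have h₁ := expand s
    rw [hgh s hs] at h₁
    generalize h s⁻¹ = c at h₁ ⊢
    field_simp
    linear_combination h₁
  rw [expand t, hk.apply_eq_of_tendsto_cocompact t hk_lim]

/-- The polarization of an entire function homogeneous of degree two. -/
theorem fderiv_apply_eq_of_homogeneous_two {E : Type*} [NormedAddCommGroup E]
    [NormedSpace ℂ E] {F : E → ℂ} (hF : Differentiable ℂ F)
    (hhom : ∀ (t : ℂ) (x : E), F (t • x) = t ^ 2 * F x) (x y : E) :
    fderiv ℂ F x y = F (x + y) - F x - F y := by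
  have hline : ∀ a b : E, Differentiable ℂ fun t : ℂ => F (a + t • b) := by
    intro a b
    fun_prop
  have hderiv : deriv (fun t : ℂ => F (x + t • y)) 0 = fderiv ℂ F x y :=
    (hF x).lineDeriv_eq_fderiv
  have key := eq_quadratic_of_inv (hline x y) (hline y x).continuous.continuousAt
    (fun t ht => by
      rw [← hhom, smul_add, smul_smul, mul_inv_cancel₀ ht, one_smul, add_comm]) 1
  rw [hderiv] at key
  simp only [one_smul, zero_smul, add_zero, one_mul, one_pow] at key
  linear_combination -key

/-- The derivative of an entire function homogeneous of degree two is a symmetric form. -/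
theorem fderiv_apply_comm_of_homogeneous_two {E : Type*} [NormedAddCommGroup E]
    [NormedSpace ℂ E] {F : E → ℂ} (hF : Differentiable ℂ F)
    (hhom : ∀ (t : ℂ) (x : E), F (t • x) = t ^ 2 * F x) (x y : E) :
    fderiv ℂ F x y = fderiv ℂ F y x := by
  rw [fderiv_apply_eq_of_homogeneous_two hF hhom, fderiv_apply_eq_of_homogeneous_two hF hhom,
    add_comm x y]
  ring

/-- For a symmetric complex matrix `M`, the imaginary part of `∑ conj(X_A) M_{AB} X_B`. -/
theorem im_sum_conj_mul_of_symm {ι : Type*} [Fintype ι] (M : ι → ι → ℂ)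
    (hM : ∀ A B, M A B = M B A) (X : ι → ℂ) :
    (∑ A, ∑ B, starRingEnd ℂ (X A) * (X B * M A B)).im =
      ∑ A, ∑ B, (M A B).im * (starRingEnd ℂ (X A) * X B).re := by
  have hanti : ∑ A, ∑ B, (M A B).re * (starRingEnd ℂ (X A) * X B).im = 0 := by
    have h : ∑ A, ∑ B, (M A B).re * (starRingEnd ℂ (X A) * X B).im =
        -∑ A, ∑ B, (M A B).re * (starRingEnd ℂ (X A) * X B).im := by
      conv_lhs => rw [Finset.sum_comm]
      simp only [← Finset.sum_neg_distrib]
      refine Finset.sum_congr rfl fun A _ => Finset.sum_congr rfl fun B _ => ?_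
      rw [hM B A]
      simp only [Complex.mul_im, Complex.conj_re, Complex.conj_im]
      ring
    linarith
  rw [← add_zero (∑ A, ∑ B, (M A B).im * (starRingEnd ℂ (X A) * X B).re), ← hanti]
  simp only [Complex.im_sum, ← Finset.sum_add_distrib]
  refine Finset.sum_congr rfl fun A _ => Finset.sum_congr rfl fun B _ => ?_
  rw [← mul_assoc, Complex.mul_im]
  ring

/-- for a holomorphic function `F` homogeneous of degree two,
`Im(∑_A conj(X_A) F_A(X)) = ∑_{A,B} Im(F_{AB}(X)) Re(conj(X_A) X_B)`. -/
theorem stmt15 (n : ℕ) (F : (Fin n → ℂ) → ℂ)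
    (hF : Differentiable ℂ F)
    (hhom : ∀ (t : ℂ) (X : Fin n → ℂ), F (t • X) = t ^ 2 * F X)
    (FA : Fin n → (Fin n → ℂ) → ℂ)
    (hFA : ∀ A X, FA A X = fderiv ℂ F X (Pi.single A 1))
    (FAB : Fin n → Fin n → (Fin n → ℂ) → ℂ)
    (hFAB : ∀ A B X, FAB A B X = fderiv ℂ (fun Y => fderiv ℂ F Y (Pi.single A 1)) X (Pi.single B 1)) :
    ∀ X : Fin n → ℂ,
      (∑ A, starRingEnd ℂ (X A) * FA A X).im =
        ∑ A, ∑ B, (FAB A B X).im * (starRingEnd ℂ (X A) * X B).re := by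
  intro X
  have hcomm := fderiv_apply_comm_of_homogeneous_two hF hhom
  have hsecond : ∀ A B, FAB A B X = fderiv ℂ F (Pi.single A 1) (Pi.single B 1) := by
    intro A B
    have hlin : (fun Y => fderiv ℂ F Y (Pi.single A 1)) = fderiv ℂ F (Pi.single A 1) :=
      funext fun Y => hcomm Y _
    rw [hFAB, hlin, ContinuousLinearMap.fderiv]
  have hfirst : ∀ A, FA A X = ∑ B, X B * FAB A B X := by
    intro A
    rw [hFA, hcomm]
    conv_lhs => rw [pi_eq_sum_univ' X, map_sum]
    refine Finset.sum_congr rfl fun B _ => ?_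
    rw [hsecond, map_smul, smul_eq_mul]
  simp only [hfirst, Finset.mul_sum]
  exact im_sum_conj_mul_of_symm (fun A B => FAB A B X)
    (fun A B => by simp only [hsecond]; exact hcomm _ _) X
end

section
/- On the real vector space E = (Fin (n+1) → ℂ) × (Fin (n+1) → ℂ), with points written (z, u), define the smooth vector fields: Q^A(z,u) = (0, e_A) and I(z,u) = (0, e₀) (constant fields), P_A(z,u) = (z₀ • e_A, −u_A • e₀), and W(z,u) = (w, v) where w₀ = 2z₀, w_A = z_A for A ≥ 1, v₀ = −2u₀, v_A = −u_A for A ≥ 1 (indices A, B range over {1,…,n}). Then, with respect to the Lie bracket of vector fields [V,W](p) = (fderiv ℝ W p)(V p) − (fderiv ℝ V p)(W p), these fields satisfy the graded Heisenberg algebra: [P_A, Q^B] = δ_{AB} • I, [P_A, P_B] = 0, [Q^A, Q^B] = 0, [I, Q^A] = 0, [I, P_A] = 0, [W, P_A] = P_A, [W, Q^A] = Q^A, and [W, I] = 2 • I. -/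
/-- The phase space `E = (Fin (n+1) → ℂ) × (Fin (n+1) → ℂ)`. -/
abbrev E (n : ℕ) := (Fin (n + 1) → ℂ) × (Fin (n + 1) → ℂ)

/-- The vector field `Q^A(z,u) = (0, e_A)`, for `A = 1,…,n`. -/
noncomputable def Qf {n : ℕ} (A : Fin n) : E n → E n :=
  fun _ => (0, Pi.single A.succ 1)

/-- The vector field `I(z,u) = (0, e₀)`. -/
noncomputable def If {n : ℕ} : E n → E n :=
  fun _ => (0, Pi.single 0 1)

/-- The vector field `P_A(z,u) = (z₀ • e_A, −u_A • e₀)`, for `A = 1,…,n`. -/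
noncomputable def Pf {n : ℕ} (A : Fin n) : E n → E n :=
  fun p => (p.1 0 • (Pi.single A.succ 1 : Fin (n + 1) → ℂ),
            -p.2 A.succ • (Pi.single 0 1 : Fin (n + 1) → ℂ))

/-- The grading vector field `W`, with `w₀ = 2z₀`, `w_A = z_A`,
`v₀ = −2u₀`, `v_A = −u_A`. -/
noncomputable def Wf {n : ℕ} : E n → E n :=
  fun p => (fun I => if I = 0 then 2 * p.1 0 else p.1 I,
            fun I => if I = 0 then -2 * p.2 0 else -p.2 I)

/-- On a finite-dimensional space the derivative of a linear map is the map itself. -/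
theorem IsLinearMap.fderiv_apply {F : Type*} [NormedAddCommGroup F] [NormedSpace ℝ F]
    [FiniteDimensional ℝ F] {f : F → F} (hf : IsLinearMap ℝ f) (x y : F) :
    fderiv ℝ f x y = f y :=
  congrArg (fun L : F →L[ℝ] F => L y) (LinearMap.toContinuousLinearMap hf.mk').fderiv

theorem isLinearMap_Pf {n : ℕ} (A : Fin n) : IsLinearMap ℝ (Pf A) where
  map_add p q := by
    ext i <;> simp [Pf] <;> ring
  map_smul c p := by
    ext i <;> simp [Pf, mul_assoc]

theorem isLinearMap_Wf {n : ℕ} : IsLinearMap ℝ (Wf : E n → E n) where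
  map_add p q := by
    ext i <;> by_cases hi : i = 0 <;> simp [Wf, hi] <;> ring
  map_smul c p := by
    ext i <;> by_cases hi : i = 0 <;> simp [Wf, hi] <;> ring

theorem fderiv_Pf {n : ℕ} (A : Fin n) (p v : E n) : fderiv ℝ (Pf A) p v = Pf A v :=
  (isLinearMap_Pf A).fderiv_apply p v

theorem fderiv_Wf {n : ℕ} (p v : E n) : fderiv ℝ Wf p v = Wf v :=
  isLinearMap_Wf.fderiv_apply p v

theorem fderiv_Qf {n : ℕ} (A : Fin n) (p : E n) : fderiv ℝ (Qf A) p = 0 :=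
  fderiv_const_apply _

theorem fderiv_If {n : ℕ} (p : E n) : fderiv ℝ If p = 0 :=
  fderiv_const_apply _

/-- the vector fields `Q^A`, `P_A`, `I`, `W` satisfy the graded
Heisenberg algebra with respect to the Lie bracket of vector fields. -/
theorem stmt18 (n : ℕ) :
    (∀ A B : Fin n, VectorField.lieBracket ℝ (Pf A) (Qf B) =
      (if A = B then (1 : ℝ) else 0) • (If : E n → E n)) ∧
    (∀ A B : Fin n, VectorField.lieBracket ℝ (Pf (n := n) A) (Pf B) = 0) ∧
    (∀ A B : Fin n, VectorField.lieBracket ℝ (Qf (n := n) A) (Qf B) = 0) ∧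
    (∀ A : Fin n, VectorField.lieBracket ℝ (If : E n → E n) (Qf A) = 0) ∧
    (∀ A : Fin n, VectorField.lieBracket ℝ (If : E n → E n) (Pf A) = 0) ∧
    (∀ A : Fin n, VectorField.lieBracket ℝ (Wf : E n → E n) (Pf A) = Pf A) ∧
    (∀ A : Fin n, VectorField.lieBracket ℝ (Wf : E n → E n) (Qf A) = Qf A) ∧
    (VectorField.lieBracket ℝ (Wf : E n → E n) If = (2 : ℝ) • (If : E n → E n)) := by
  refine ⟨fun A B => ?_, fun A B => ?_, fun A B => ?_, fun A => ?_, fun A => ?_, fun A => ?_,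
    fun A => ?_, ?_⟩ <;> funext p <;>
    simp only [VectorField.lieBracket, fderiv_Pf, fderiv_Wf, fderiv_Qf, fderiv_If]
  · by_cases h : A = B <;> ext i <;> simp [Pf, Qf, If, h]
  · ext i <;> simp [Pf]
  · simp
  · simp
  · ext i <;> simp [Pf, If]
  · ext i <;> by_cases hi : i = 0 <;> simp [Pf, Wf, hi] <;> ring
  · ext i <;> by_cases hi : i = 0 <;> simp [Qf, Wf, hi]
  · ext i <;> by_cases hi : i = 0 <;> simp [If, Wf, hi]
end

section
/- On E = (Fin (n+1) → ℂ) × (Fin (n+1) → ℂ) define the complex symplectic pairing Ω((a,b),(a',b')) := ∑_{I=0}^{n} (b_I · a'_I − b'_I · a_I) ∈ ℂ, and on the open set D = { (z,u) ∈ E : z₀ ≠ 0 } define the dualization map φ(z,u) = (z', u') by z'₀ = z₀, z'_A = −z₀ · u_A for A = 1,…,n, u'₀ = u₀ + ∑_{A=1}^{n} (z_A/z₀) · u_A, and u'_A = z_A/z₀ for A = 1,…,n. Then φ is complex-differentiable on D, and its derivative preserves the symplectic pairing: for every p ∈ D and all v, w ∈ E, Ω( (fderiv ℂ φ p) v, (fderiv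 ℂ φ p) w ) = Ω(v, w). -/
/-- The complex symplectic pairing `Ω((a,b),(a',b')) = ∑_I (b_I a'_I − b'_I a_I)`. -/
noncomputable def Om {n : ℕ} (v w : E n) : ℂ :=
  ∑ I : Fin (n + 1), (v.2 I * w.1 I - w.2 I * v.1 I)

/-- The dualization map `φ(z,u) = (z',u')` with `z'₀ = z₀`, `z'_A = −z₀u_A`,
`u'₀ = u₀ + ∑_A (z_A/z₀)u_A`, `u'_A = z_A/z₀`. -/
noncomputable def phi {n : ℕ} : E n → E n :=
  fun p => (fun I => if I = 0 then p.1 0 else -(p.1 0) * p.2 I,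
            fun I => if I = 0 then p.2 0 + ∑ A : Fin n, (p.1 A.succ / p.1 0) * p.2 A.succ
                     else p.1 I / p.1 0)

theorem differentiableAt_phi {n : ℕ} {p : E n} (hp : p.1 0 ≠ 0) :
    DifferentiableAt ℂ (phi : E n → E n) p := by
  unfold phi
  refine DifferentiableAt.prodMk (differentiableAt_pi.2 fun I => ?_)
    (differentiableAt_pi.2 fun I => ?_)
  · by_cases hI : I = 0
    · simp only [hI, if_true]
      fun_prop
    · simp only [hI, if_false]
      fun_prop
  · by_cases hI : I = 0
    · simp only [hI, if_true]
      fun_prop (disch := exact hp)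
    · simp only [hI, if_false]
      fun_prop (disch := exact hp)

theorem hasFDerivAt_fst_apply {n : ℕ} (p : E n) (I : Fin (n + 1)) :
    HasFDerivAt (fun q : E n => q.1 I)
      ((ContinuousLinearMap.proj I).comp (ContinuousLinearMap.fst ℂ _ _)) p :=
  ((ContinuousLinearMap.proj (R := ℂ) (φ := fun _ : Fin (n + 1) => ℂ) I).comp
    (ContinuousLinearMap.fst ℂ (Fin (n + 1) → ℂ) (Fin (n + 1) → ℂ))).hasFDerivAt

theorem hasFDerivAt_snd_apply {n : ℕ} (p : E n) (I : Fin (n + 1)) :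
    HasFDerivAt (fun q : E n => q.2 I)
      ((ContinuousLinearMap.proj I).comp (ContinuousLinearMap.snd ℂ _ _)) p :=
  ((ContinuousLinearMap.proj (R := ℂ) (φ := fun _ : Fin (n + 1) => ℂ) I).comp
    (ContinuousLinearMap.snd ℂ (Fin (n + 1) → ℂ) (Fin (n + 1) → ℂ))).hasFDerivAt

theorem hasFDerivAt_phi_fst {n : ℕ} {p : E n} (hp : p.1 0 ≠ 0) (I : Fin (n + 1)) :
    HasFDerivAt (fun q : E n => (phi q).1 I) ((ContinuousLinearMap.proj I).comp
      ((ContinuousLinearMap.fst ℂ _ _).comp (fderiv ℂ (phi : E n → E n) p))) p :=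
  (hasFDerivAt_fst_apply (phi p) I).comp p (differentiableAt_phi hp).hasFDerivAt

theorem hasFDerivAt_phi_snd {n : ℕ} {p : E n} (hp : p.1 0 ≠ 0) (I : Fin (n + 1)) :
    HasFDerivAt (fun q : E n => (phi q).2 I) ((ContinuousLinearMap.proj I).comp
      ((ContinuousLinearMap.snd ℂ _ _).comp (fderiv ℂ (phi : E n → E n) p))) p :=
  (hasFDerivAt_snd_apply (phi p) I).comp p (differentiableAt_phi hp).hasFDerivAt

theorem fderiv_phi_fst_zero {n : ℕ} {p : E n} (hp : p.1 0 ≠ 0) (v : E n) :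
    (fderiv ℂ (phi : E n → E n) p v).1 0 = v.1 0 :=
  DFunLike.congr_fun ((hasFDerivAt_phi_fst hp 0).unique (hasFDerivAt_fst_apply p 0)) v

theorem fderiv_phi_fst_succ {n : ℕ} {p : E n} (hp : p.1 0 ≠ 0) (v : E n) (A : Fin n) :
    (fderiv ℂ (phi : E n → E n) p v).1 A.succ =
      -(p.1 0 * v.2 A.succ + p.2 A.succ * v.1 0) := by
  have h := (hasFDerivAt_phi_fst hp A.succ).unique
    (((hasFDerivAt_fst_apply p 0).neg.mul (hasFDerivAt_snd_apply p A.succ)).congr_of_eventuallyEq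
      (Filter.Eventually.of_forall fun q => by simp [phi, Fin.succ_ne_zero]))
  have h' := DFunLike.congr_fun h v
  simp at h'
  rw [h']
  ring

theorem hasFDerivAt_fst_div {n : ℕ} {p : E n} (hp : p.1 0 ≠ 0) (I : Fin (n + 1)) :
    ∃ L : E n →L[ℂ] ℂ, HasFDerivAt (fun q : E n => q.1 I / q.1 0) L p ∧
      ∀ v, L v = v.1 I / p.1 0 - p.1 I * v.1 0 / p.1 0 ^ 2 := by
  refine ⟨_, ((hasFDerivAt_fst_apply p I).mul ((hasDerivAt_inv hp).comp_hasFDerivAt p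
    (hasFDerivAt_fst_apply p 0))).congr_of_eventuallyEq
    (Filter.Eventually.of_forall fun q => by simp [div_eq_mul_inv]), fun v => ?_⟩
  simp
  field_simp
  ring

theorem fderiv_phi_snd_succ {n : ℕ} {p : E n} (hp : p.1 0 ≠ 0) (v : E n) (A : Fin n) :
    (fderiv ℂ (phi : E n → E n) p v).2 A.succ =
      v.1 A.succ / p.1 0 - p.1 A.succ * v.1 0 / p.1 0 ^ 2 := by
  obtain ⟨L, hL, hLv⟩ := hasFDerivAt_fst_div hp A.succ
  rw [← hLv]
  exact DFunLike.congr_fun ((hasFDerivAt_phi_snd hp A.succ).unique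
    (hL.congr_of_eventuallyEq
      (Filter.Eventually.of_forall fun q => by simp [phi, Fin.succ_ne_zero]))) v

theorem fderiv_phi_snd_zero {n : ℕ} {p : E n} (hp : p.1 0 ≠ 0) (v : E n) :
    (fderiv ℂ (phi : E n → E n) p v).2 0 =
      v.2 0 + ∑ A : Fin n, (p.1 A.succ / p.1 0 * v.2 A.succ +
        p.2 A.succ * (v.1 A.succ / p.1 0 - p.1 A.succ * v.1 0 / p.1 0 ^ 2)) := by
  choose L hL hLv using fun I => hasFDerivAt_fst_div hp I
  have h := (hasFDerivAt_phi_snd hp 0).unique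
    (((hasFDerivAt_snd_apply p 0).add (HasFDerivAt.fun_sum (u := Finset.univ)
      fun (A : Fin n) _ => (hL A.succ).mul (hasFDerivAt_snd_apply p A.succ))).congr_of_eventuallyEq
      (Filter.Eventually.of_forall fun q => by simp [phi]))
  have h' := DFunLike.congr_fun h v
  simpa [hLv] using h'

/-- the dualization map is complex-differentiable on
`D = {z₀ ≠ 0}` and its derivative preserves the symplectic pairing. -/
theorem stmt19 (n : ℕ) (D : Set (E n)) (hD : D = {p : E n | p.1 0 ≠ 0}) :
    DifferentiableOn ℂ (phi : E n → E n) D ∧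
    ∀ p ∈ D, ∀ v w : E n,
      Om (fderiv ℂ (phi : E n → E n) p v) (fderiv ℂ (phi : E n → E n) p w) = Om v w := by
  subst hD
  refine ⟨fun p hp => (differentiableAt_phi hp).differentiableWithinAt, fun p hp v w => ?_⟩
  replace hp : p.1 0 ≠ 0 := hp
  simp only [Om, Fin.sum_univ_succ, fderiv_phi_fst_zero hp, fderiv_phi_fst_succ hp,
    fderiv_phi_snd_zero hp, fderiv_phi_snd_succ hp]
  rw [add_mul, add_mul, Finset.sum_mul, Finset.sum_mul, add_sub_add_comm, add_assoc,
    ← Finset.sum_sub_distrib, ← Finset.sum_add_distrib]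
  congr 1
  refine Finset.sum_congr rfl fun A _ => ?_
  field_simp
  ring
end
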